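/- Let ε : (Fin 4)⁴ → ℝ be the Levi-Civita symbol: ε(σ(0),σ(1),σ(2),σ(3)) = sign(σ) for every permutation σ of Fin 4, and ε(α,β,γ,δ) = 0 whenever the indices are not pairwise distinct. Let U ⊆ ℝ⁴ be open, φ : U → ℝ differentiable, A ∈ ℝ, and define H(μ,ν,ρ)(x) := A·exp(2φ(x))·Σ_{α} ε(α,μ,ν,ρ)·∂_αφ(x). Define the energy-momentum tensor T_{μν}(x) := 2·∂_μφ·∂_νφ + (1/2)·exp(−4φ)·Σ_{α,β} H(μ,α,β)·H(ν,α,β) − δ_{μν}·( Σ_α (∂_αφ)² + (1/12)·exp(−4φ)·Σ_{α,β,γ} H(α,β,γ)² ), all evaluated at x. Then for all μ, ν and all x ∈ U: T_{μν}(x) = (2 − A²)·( ∂_μφ(x)·∂_νφ(x) − (1/2)·δ_{μν}·Σ_α (∂_αφ(x))² ). In particular T_{μν} ≡ 0 when A² = 2. -/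

import Mathlib

/-- The `μ`-th standard basis vector of Euclidean ℝ⁴. -/
noncomputable def e4 (μ : Fin 4) : EuclideanSpace ℝ (Fin 4) :=
  EuclideanSpace.single μ 1

/-- Integer model of the Levi-Civita symbol: a normalized Vandermonde product. -/
def lcInt (a b c d : Fin 4) : ℤ :=
  (((b : ℕ) : ℤ) - ((a : ℕ) : ℤ)) * (((c : ℕ) : ℤ) - ((a : ℕ) : ℤ)) *
  (((d : ℕ) : ℤ) - ((a : ℕ) : ℤ)) * (((c : ℕ) : ℤ) - ((b : ℕ) : ℤ)) *
  (((d : ℕ) : ℤ) - ((b : ℕ) : ℤ)) * (((d : ℕ) : ℤ) - ((c : ℕ) : ℤ)) / 12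

theorem sign_eq_lcInt : ∀ σ : Equiv.Perm (Fin 4),
    ((Equiv.Perm.sign σ : ℤˣ) : ℤ) = lcInt (σ 0) (σ 1) (σ 2) (σ 3) := by
  decide +kernel

theorem lcInt_degenerate : ∀ a b c d : Fin 4,
    (a = b ∨ a = c ∨ a = d ∨ b = c ∨ b = d ∨ c = d) → lcInt a b c d = 0 := by
  decide +kernel

theorem nondegenerate_bijective : ∀ a b c d : Fin 4,
    ¬ (a = b ∨ a = c ∨ a = d ∨ b = c ∨ b = d ∨ c = d) →
      Function.Injective ![a, b, c, d] := by
  decide +kernel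

theorem lcInt_contract : ∀ ρ σ μ ν : Fin 4,
    ∑ α, ∑ β, lcInt ρ μ α β * lcInt σ ν α β =
      2 * ((if μ = ν then 1 else 0) * (if ρ = σ then 1 else 0)
        - (if ρ = ν then 1 else 0) * (if σ = μ then 1 else 0)) := by
  decide +kernel

theorem eps_eq (ε : Fin 4 → Fin 4 → Fin 4 → Fin 4 → ℝ)
    (hperm : ∀ σ : Equiv.Perm (Fin 4),
      ε (σ 0) (σ 1) (σ 2) (σ 3) = ((Equiv.Perm.sign σ : ℤ) : ℝ))
    (hzero : ∀ α β γ δ : Fin 4,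
      (α = β ∨ α = γ ∨ α = δ ∨ β = γ ∨ β = δ ∨ γ = δ) → ε α β γ δ = 0)
    (a b c d : Fin 4) : ε a b c d = (lcInt a b c d : ℝ) := by
  by_cases h : (a = b ∨ a = c ∨ a = d ∨ b = c ∨ b = d ∨ c = d)
  · rw [hzero _ _ _ _ h, lcInt_degenerate _ _ _ _ h]; simp
  · have hi := nondegenerate_bijective a b c d h
    have hb := Finite.injective_iff_bijective.mp hi
    have := hperm (Equiv.ofBijective _ hb)
    rw [sign_eq_lcInt] at this
    simpa using this

theorem eps_contract (ρ σ μ ν : Fin 4) :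
    ∑ α, ∑ β, (lcInt ρ μ α β : ℝ) * (lcInt σ ν α β : ℝ) =
      2 * ((if μ = ν then 1 else 0) * (if ρ = σ then 1 else 0)
        - (if ρ = ν then 1 else 0) * (if σ = μ then 1 else 0)) := by
  exact_mod_cast congrArg (Int.cast : ℤ → ℝ) (lcInt_contract ρ σ μ ν)

theorem sum_HH (p : Fin 4 → ℝ) (μ ν : Fin 4) :
    ∑ α, ∑ β, (∑ ρ, (lcInt ρ μ α β : ℝ) * p ρ) * (∑ σ, (lcInt σ ν α β : ℝ) * p σ) =
      2 * ((if μ = ν then 1 else 0) * ∑ α, p α ^ 2 - p μ * p ν) := by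
  have h1 : ∑ α, ∑ β, (∑ ρ, (lcInt ρ μ α β : ℝ) * p ρ) * (∑ σ, (lcInt σ ν α β : ℝ) * p σ)
      = ∑ ρ, ∑ σ, p ρ * p σ * ∑ α, ∑ β, (lcInt ρ μ α β : ℝ) * (lcInt σ ν α β : ℝ) := by
    simp only [Finset.sum_mul_sum]
    simp only [Finset.mul_sum]
    calc _ = ∑ α, ∑ ρ, ∑ β, ∑ σ, (lcInt ρ μ α β : ℝ) * p ρ * ((lcInt σ ν α β : ℝ) * p σ) :=
          Finset.sum_congr rfl fun _ _ => Finset.sum_comm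
      _ = ∑ ρ, ∑ α, ∑ β, ∑ σ, (lcInt ρ μ α β : ℝ) * p ρ * ((lcInt σ ν α β : ℝ) * p σ) :=
          Finset.sum_comm
      _ = ∑ ρ, ∑ α, ∑ σ, ∑ β, (lcInt ρ μ α β : ℝ) * p ρ * ((lcInt σ ν α β : ℝ) * p σ) :=
          Finset.sum_congr rfl fun _ _ => Finset.sum_congr rfl fun _ _ => Finset.sum_comm
      _ = ∑ ρ, ∑ σ, ∑ α, ∑ β, (lcInt ρ μ α β : ℝ) * p ρ * ((lcInt σ ν α β : ℝ) * p σ) :=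
          Finset.sum_congr rfl fun _ _ => Finset.sum_comm
      _ = _ := by
          refine Finset.sum_congr rfl fun _ _ => Finset.sum_congr rfl fun _ _ =>
            Finset.sum_congr rfl fun _ _ => Finset.sum_congr rfl fun _ _ => ?_
          ring
  rw [h1]
  simp only [eps_contract]
  simp only [mul_sub, Finset.sum_sub_distrib]
  congr 1
  · by_cases h : μ = ν
    · simp [h, Finset.mul_sum]
      exact Finset.sum_congr rfl fun _ _ => by ring
    · simp [h]
  · simp
    ring

/-- For the instanton ansatz `H_{μνρ} = A e^{2φ} ε^α{}_{μνρ}∂_αφ`, the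
flat-space energy-momentum tensor of the dilaton-tensor system satisfies
`T_{μν} = (2 − A²)(∂_μφ∂_νφ − (1/2)δ_{μν}Σ_α(∂_αφ)²)`; in particular
`T_{μν} ≡ 0` when `A² = 2`. -/
theorem energy_momentum_of_instanton_ansatz
    (ε : Fin 4 → Fin 4 → Fin 4 → Fin 4 → ℝ)
    (hperm : ∀ σ : Equiv.Perm (Fin 4),
      ε (σ 0) (σ 1) (σ 2) (σ 3) = ((Equiv.Perm.sign σ : ℤ) : ℝ))
    (hzero : ∀ α β γ δ : Fin 4,
      (α = β ∨ α = γ ∨ α = δ ∨ β = γ ∨ β = δ ∨ γ = δ) → ε α β γ δ = 0)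
    (U : Set (EuclideanSpace ℝ (Fin 4))) (hU : IsOpen U)
    (φ : EuclideanSpace ℝ (Fin 4) → ℝ) (hφ : DifferentiableOn ℝ φ U)
    (A : ℝ) :
    let H : Fin 4 → Fin 4 → Fin 4 → EuclideanSpace ℝ (Fin 4) → ℝ :=
      fun μ ν ρ x => A * Real.exp (2 * φ x) * ∑ α, ε α μ ν ρ * fderiv ℝ φ x (e4 α)
    let T : Fin 4 → Fin 4 → EuclideanSpace ℝ (Fin 4) → ℝ :=
      fun μ ν x => 2 * fderiv ℝ φ x (e4 μ) * fderiv ℝ φ x (e4 ν)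
        + 1 / 2 * Real.exp (-4 * φ x) * ∑ α, ∑ β, H μ α β x * H ν α β x
        - (if μ = ν then (1 : ℝ) else 0)
          * (∑ α, (fderiv ℝ φ x (e4 α)) ^ 2
            + 1 / 12 * Real.exp (-4 * φ x) * ∑ α, ∑ β, ∑ γ, (H α β γ x) ^ 2)
    (∀ μ ν : Fin 4, ∀ x ∈ U,
      T μ ν x = (2 - A ^ 2) * (fderiv ℝ φ x (e4 μ) * fderiv ℝ φ x (e4 ν)
        - 1 / 2 * (if μ = ν then (1 : ℝ) else 0)
          * ∑ α, (fderiv ℝ φ x (e4 α)) ^ 2)) ∧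
    (A ^ 2 = 2 → ∀ μ ν : Fin 4, ∀ x ∈ U, T μ ν x = 0) := by
  intro H T
  have key : ∀ μ ν : Fin 4, ∀ x ∈ U,
      T μ ν x = (2 - A ^ 2) * (fderiv ℝ φ x (e4 μ) * fderiv ℝ φ x (e4 ν)
        - 1 / 2 * (if μ = ν then (1 : ℝ) else 0)
          * ∑ α, (fderiv ℝ φ x (e4 α)) ^ 2) := by
    intro μ ν x _
    have hHH : ∀ μ ν : Fin 4, ∑ α, ∑ β, H μ α β x * H ν α β x =
        A ^ 2 * Real.exp (2 * φ x) ^ 2 * (2 * ((if μ = ν then 1 else 0) *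
          ∑ α, (fderiv ℝ φ x (e4 α)) ^ 2 - fderiv ℝ φ x (e4 μ) * fderiv ℝ φ x (e4 ν))) := by
      intro μ ν
      rw [← sum_HH (fun α => fderiv ℝ φ x (e4 α)) μ ν]
      simp only [H, eps_eq ε hperm hzero]
      rw [Finset.mul_sum]
      refine Finset.sum_congr rfl fun _ _ => ?_
      rw [Finset.mul_sum]
      refine Finset.sum_congr rfl fun _ _ => ?_
      ring
    have hsq : ∑ α, ∑ β, ∑ γ, (H α β γ x) ^ 2 =
        A ^ 2 * Real.exp (2 * φ x) ^ 2 * (6 * ∑ α, (fderiv ℝ φ x (e4 α)) ^ 2) := by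
      simp only [pow_two (H _ _ _ x), hHH]
      simp only [Fin.sum_univ_four, if_true]
      ring
    have hexp : Real.exp (-4 * φ x) * Real.exp (2 * φ x) ^ 2 = 1 := by
      rw [← Real.exp_nat_mul, ← Real.exp_add, Real.exp_eq_one_iff]
      push_cast
      ring
    simp only [T]
    rw [hHH, hsq]
    generalize (∑ α, (fderiv ℝ φ x (e4 α)) ^ 2) = S
    generalize (if μ = ν then (1 : ℝ) else 0) = δ
    linear_combination (A ^ 2 * (δ * S - fderiv ℝ φ x (e4 μ) * fderiv ℝ φ x (e4 ν))
      - δ * A ^ 2 * S / 2) * hexp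
  refine ⟨key, fun hA μ ν x hx => ?_⟩
  rw [key μ ν x hx, hA]
  ring
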